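/- Let Ω ⊂ ℝ^d be a nonempty, bounded, uniform domain, let 0 < s < 1, 1 ≤ p < ∞ and let α, β ≥ 0 satisfy α < codim̲_A(∂Ω), β < codim̲_A(∂Ω) and α+β < codim̲_A(∂Ω). Then the seminorms [f]_{W^{s,p;α,β}(Ω)} and [f]_{W^{s,p;α+β,0}(Ω)} are comparable for f ∈ L¹_loc(Ω); more precisely, [f]_{W^{s,p;α,β}(Ω)} ≤ 2^{1/p} [f]_{W^{s,p;α+β,0}(Ω)}, and there exists a constant c > 0 (independent of f) with [f]_{W^{s,p;α+β,0}(Ω)} ≤ c [f]_{W^{s,p;α,β}(Ω)}. -/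

import Mathlib

open MeasureTheory Metric Set Filter
open scoped ENNReal NNReal

noncomputable section

/-- Euclidean space `ℝ^d`. -/
abbrev Rd (d : ℕ) := EuclideanSpace ℝ (Fin d)

/-- `d_Ω(x)`: the distance from `x` to the boundary `∂Ω`. -/
def distBd {d : ℕ} (Ω : Set (Rd d)) (x : Rd d) : ℝ := Metric.infDist x (frontier Ω)

/-- The `p`-th power of the weighted Gagliardo seminorm `[f]_{W^{s,p;α,β}(Ω)}^p`, with
power-of-distance-to-the-boundary weights `d_Ω(y)^{-β} d_Ω(x)^{-α}`. -/
def gagP {d : ℕ} (Ω : Set (Rd d)) (s p α β : ℝ) (f : Rd d → ℝ) : ℝ≥0∞ :=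
  ∫⁻ x in Ω, ∫⁻ y in Ω, ENNReal.ofReal
    (|f x - f y| ^ p / dist x y ^ ((d : ℝ) + s * p)
      * distBd Ω y ^ (-β) * distBd Ω x ^ (-α))

/-- The weighted Gagliardo seminorm `[f]_{W^{s,p;α,β}(Ω)}`. -/
def gagSemi {d : ℕ} (Ω : Set (Rd d)) (s p α β : ℝ) (f : Rd d → ℝ) : ℝ≥0∞ :=
  gagP Ω s p α β f ^ (1 / p)

/-- Membership in the weighted fractional Sobolev space `W^{s,p;α,β}(Ω)`. -/
def memW {d : ℕ} (Ω : Set (Rd d)) (s p α β : ℝ) (f : Rd d → ℝ) : Prop :=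
  MemLp f (ENNReal.ofReal p) (volume.restrict Ω) ∧ gagP Ω s p α β f < ⊤

/-- The norm `‖f‖_{L^p(Ω)} + [f]_{W^{s,p;α,β}(Ω)}` (as an extended real). -/
def wNorm {d : ℕ} (Ω : Set (Rd d)) (s p α β : ℝ) (f : Rd d → ℝ) : ℝ≥0∞ :=
  eLpNorm f (ENNReal.ofReal p) (volume.restrict Ω) + gagSemi Ω s p α β f

/-- Membership in `W_0^{s,p;α,β}(Ω)`: the closure of `C_c^∞(Ω) ∩ W^{s,p;α,β}(Ω)` in
`W^{s,p;α,β}(Ω)`. -/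
def memW0 {d : ℕ} (Ω : Set (Rd d)) (s p α β : ℝ) (f : Rd d → ℝ) : Prop :=
  memW Ω s p α β f ∧ ∀ ε : ℝ, 0 < ε → ∃ φ : Rd d → ℝ,
    ContDiff ℝ (⊤ : ℕ∞) φ ∧ HasCompactSupport φ ∧ tsupport φ ⊆ Ω ∧ memW Ω s p α β φ ∧
    wNorm Ω s p α β (fun x => f x - φ x) < ENNReal.ofReal ε

/-- The defining set for the lower Assouad codimension: admissible exponents `q`. -/
def lowerCodimSet {d : ℕ} (E : Set (Rd d)) : Set ℝ :=
  {q : ℝ | 0 ≤ q ∧ ∃ C : ℝ, 1 ≤ C ∧ ∀ x ∈ E, ∀ r R : ℝ, 0 < r → r < R →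
    ENNReal.ofReal R < EMetric.diam E →
    volume (Metric.cthickening r E ∩ Metric.ball x R)
      ≤ ENNReal.ofReal (C * (r / R) ^ q) * volume (Metric.ball x R)}

/-- The lower Assouad codimension. -/
def lowerCodimA {d : ℕ} (E : Set (Rd d)) : ℝ := sSup (lowerCodimSet E)

/-- The upper Assouad codimension. -/
def upperCodimA {d : ℕ} (E : Set (Rd d)) : ℝ :=
  sInf {q : ℝ | 0 ≤ q ∧ ∃ c : ℝ, 0 < c ∧ ∀ x ∈ E, ∀ r R : ℝ, 0 < r → r < R →
    ENNReal.ofReal R < EMetric.diam E →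
    ENNReal.ofReal (c * (r / R) ^ q) * volume (Metric.ball x R)
      ≤ volume (Metric.cthickening r E ∩ Metric.ball x R)}

/-- The upper Minkowski dimension. -/
def upperMinkDim {d : ℕ} (E : Set (Rd d)) : ℝ :=
  sInf {t : ℝ | 0 ≤ t ∧
    Filter.limsup (fun r : ℝ =>
        volume (Metric.cthickening r E) * ENNReal.ofReal (r ^ (t - (d : ℝ))))
      (nhdsWithin 0 (Set.Ioi 0)) = 0}

/-- Uniform domain: any two points are joined by a `1`-Lipschitz (arc-length parameterized)
curve of length `≤ C|x-y|` staying quantitatively away from the boundary. -/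
def IsUniformDomain {d : ℕ} (Ω : Set (Rd d)) : Prop :=
  ∃ C : ℝ, 1 ≤ C ∧ ∀ x ∈ Ω, ∀ y ∈ Ω, ∃ (l : ℝ) (γ : ℝ → Rd d),
    0 ≤ l ∧ l ≤ C * dist x y ∧ γ 0 = x ∧ γ l = y ∧
    (∀ t ∈ Set.Icc 0 l, γ t ∈ Ω) ∧
    LipschitzOnWith 1 γ (Set.Icc 0 l) ∧
    ∀ t ∈ Set.Icc 0 l,
      min (dist (γ t) x) (dist (γ t) y) / C ≤ Metric.infDist (γ t) (frontier Ω)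

/-- `κ`-plumpness. -/
def IsPlump {d : ℕ} (κ : ℝ) (E : Set (Rd d)) : Prop :=
  ∀ r : ℝ, 0 < r → ENNReal.ofReal r < EMetric.diam E →
    ∀ x ∈ closure E, ∃ z ∈ Metric.closedBall x r, Metric.ball z (κ * r) ⊆ E

/-- `σ`-homogeneity: `|V(E,x,λ,r)| ≤ L r^d λ^σ` where
`V(E,x,λ,r) = {y : dist(y,E) ≤ r, |x-y| ≤ λ r}`. -/
def IsHomog {d : ℕ} (σ : ℝ) (E : Set (Rd d)) : Prop :=
  ∃ L : ℝ, 0 < L ∧ ∀ x ∈ E, ∀ lam r : ℝ, 1 ≤ lam → 0 < r →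
    volume (Metric.cthickening r E ∩ Metric.closedBall x (lam * r))
      ≤ ENNReal.ofReal (L * r ^ (d : ℝ) * lam ^ σ)

/-- The axis-parallel cube with corner `a` and side length `l`. -/
def cube {d : ℕ} (a : Rd d) (l : ℝ) : Set (Rd d) :=
  {y | ∀ i, y i ∈ Set.Icc (a i) (a i + l)}

/-- Muckenhoupt `A₁` class: `|Q|⁻¹ ∫_Q w ≤ A inf_Q w` for all cubes `Q`. -/
def IsA1 {d : ℕ} (w : Rd d → ℝ) : Prop :=
  (∀ x, 0 < w x) ∧ ∃ A : ℝ, 0 < A ∧ ∀ (a : Rd d) (l : ℝ), 0 < l →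
    ∫⁻ x in cube a l, ENNReal.ofReal (w x)
      ≤ ENNReal.ofReal (A * l ^ (d : ℝ)) * ⨅ y ∈ cube a l, ENNReal.ofReal (w y)

/-- The `p`-th power of the Gagliardo seminorm with general weights `w(x) v(y)`. -/
def gagPW {d : ℕ} (Ω : Set (Rd d)) (s p : ℝ) (w v f : Rd d → ℝ) : ℝ≥0∞ :=
  ∫⁻ x in Ω, ∫⁻ y in Ω, ENNReal.ofReal
    (|f x - f y| ^ p / dist x y ^ ((d : ℝ) + s * p) * w x * v y)

/-- Membership in `W^{s,p;w,v}(Ω)` for general weights. -/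
def memWgen {d : ℕ} (Ω : Set (Rd d)) (s p : ℝ) (w v f : Rd d → ℝ) : Prop :=
  MemLp f (ENNReal.ofReal p) (volume.restrict Ω) ∧ gagPW Ω s p w v f < ⊤

/-- The norm of `W^{s,p;w,v}(Ω)` (as an extended real). -/
def wNormGen {d : ℕ} (Ω : Set (Rd d)) (s p : ℝ) (w v f : Rd d → ℝ) : ℝ≥0∞ :=
  eLpNorm f (ENNReal.ofReal p) (volume.restrict Ω) + gagPW Ω s p w v f ^ (1 / p)

/-- Membership in `W_0^{s,p;w,v}(Ω)`. -/
def memW0gen {d : ℕ} (Ω : Set (Rd d)) (s p : ℝ) (w v f : Rd d → ℝ) : Prop :=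
  memWgen Ω s p w v f ∧ ∀ ε : ℝ, 0 < ε → ∃ φ : Rd d → ℝ,
    ContDiff ℝ (⊤ : ℕ∞) φ ∧ HasCompactSupport φ ∧ tsupport φ ⊆ Ω ∧ memWgen Ω s p w v φ ∧
    wNormGen Ω s p w v (fun x => f x - φ x) < ENNReal.ofReal ε

/-- Membership in `W_c^{s,p;w,v}(Ω)`: the closure of compactly supported measurable
functions. -/
def memWcgen {d : ℕ} (Ω : Set (Rd d)) (s p : ℝ) (w v f : Rd d → ℝ) : Prop :=
  memWgen Ω s p w v f ∧ ∀ ε : ℝ, 0 < ε → ∃ g : Rd d → ℝ,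
    Measurable g ∧ HasCompactSupport g ∧ tsupport g ⊆ Ω ∧ memWgen Ω s p w v g ∧
    wNormGen Ω s p w v (fun x => f x - g x) < ENNReal.ofReal ε

end


section Covering

/-- A geometric-series bound for an integral over a set covered by countably many pieces. -/
lemma setLIntegral_le_of_geometric_cover {X : Type*} [MeasurableSpace X] {μ : Measure X}
    {S : Set X} (hS : MeasurableSet S) {φ : X → ℝ≥0∞} {A : ℕ → Set X}
    (hA : ∀ k, MeasurableSet (A k)) {c : ℕ → ℝ≥0∞}
    (hcov : ∀ x ∈ S, ∃ k, x ∈ A k ∧ φ x ≤ c k) {B θ : ℝ} (hB : 0 ≤ B) (hθ0 : 0 ≤ θ)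
    (hθ1 : θ < 1) (hsum : ∀ k, c k * μ (A k) ≤ ENNReal.ofReal (B * θ ^ k)) :
    ∫⁻ x in S, φ x ∂μ ≤ ENNReal.ofReal (B / (1 - θ)) := by
  calc ∫⁻ x in S, φ x ∂μ
      ≤ ∫⁻ x in S, ∑' k, (A k).indicator (fun _ => c k) x ∂μ := by
        refine setLIntegral_mono' hS fun x hx => ?_
        obtain ⟨k, hk, hφ⟩ := hcov x hx
        refine le_trans ?_ (ENNReal.le_tsum k)
        simpa [hk] using hφ
    _ ≤ ∫⁻ x, ∑' k, (A k).indicator (fun _ => c k) x ∂μ := setLIntegral_le_lintegral _ _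
    _ = ∑' k, c k * μ (A k) := by
        rw [lintegral_tsum fun k => (measurable_const.indicator (hA k)).aemeasurable]
        simp [hA]
    _ ≤ ∑' k, ENNReal.ofReal (B * θ ^ k) := ENNReal.tsum_le_tsum hsum
    _ = ENNReal.ofReal (∑' k, B * θ ^ k) :=
        (ENNReal.ofReal_tsum_of_nonneg (fun k => by positivity)
          ((summable_geometric_of_lt_one hθ0 hθ1).mul_left B)).symm
    _ = ENNReal.ofReal (B / (1 - θ)) := by
        rw [tsum_mul_left, tsum_geometric_of_lt_one hθ0 hθ1, div_eq_mul_inv]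

end Covering

section Balls

variable {d : ℕ}

/-- The volume of the unit ball of `ℝ^d`, as a real number. -/
noncomputable def unitBallVol (d : ℕ) : ℝ := (volume (ball (0 : Rd d) 1)).toReal

lemma unitBallVol_pos (d : ℕ) : 0 < unitBallVol d :=
  ENNReal.toReal_pos (measure_ball_pos _ _ one_pos).ne' measure_ball_lt_top.ne

lemma volume_ball_eq (x : Rd d) {R : ℝ} (hR : 0 < R) :
    volume (ball x R) = ENNReal.ofReal (R ^ (d : ℝ) * unitBallVol d) := by
  rw [Measure.addHaar_ball_of_pos volume x hR, finrank_euclideanSpace_fin,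
    ENNReal.ofReal_mul (by positivity), unitBallVol, ENNReal.ofReal_toReal measure_ball_lt_top.ne,
    Real.rpow_natCast]

/-- The tail of a non-critical power of the distance. -/
lemma exists_setLIntegral_dist_rpow_le {m : ℝ} (hm : (d : ℝ) < m) :
    ∃ C : ℝ, 0 < C ∧ ∀ (x : Rd d) (a : ℝ), 0 < a →
      ∫⁻ y in {y | a ≤ dist x y}, ENNReal.ofReal (dist x y ^ (-m))
        ≤ ENNReal.ofReal (C * a ^ ((d : ℝ) - m)) := by
  have hθ : (2 : ℝ) ^ ((d : ℝ) - m) < 1 :=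
    Real.rpow_lt_one_of_one_lt_of_neg one_lt_two (by linarith)
  have hθ' : 0 < 1 - (2 : ℝ) ^ ((d : ℝ) - m) := by linarith
  have hv := unitBallVol_pos d
  refine ⟨2 ^ (d : ℝ) * unitBallVol d / (1 - 2 ^ ((d : ℝ) - m)), by positivity, ?_⟩
  intro x a ha
  have key := setLIntegral_le_of_geometric_cover (μ := (volume : Measure (Rd d)))
    (S := {y | a ≤ dist x y}) (measurableSet_le (by fun_prop) (by fun_prop))
    (φ := fun y => ENNReal.ofReal (dist x y ^ (-m)))
    (A := fun k => ball x (2 ^ (k + 1) * a)) (fun k => measurableSet_ball)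
    (c := fun k => ENNReal.ofReal ((2 ^ k * a) ^ (-m)))
    (B := 2 ^ (d : ℝ) * unitBallVol d * a ^ ((d : ℝ) - m)) (θ := 2 ^ ((d : ℝ) - m))
    ?_ (by positivity) (by positivity) hθ ?_
  · refine key.trans (ENNReal.ofReal_le_ofReal (le_of_eq ?_))
    ring
  · intro y hy
    simp only [mem_ofPred_eq] at hy
    obtain ⟨k, hk1, hk2⟩ := exists_nat_pow_near (x := dist x y / a) (y := (2 : ℝ))
      (by rwa [one_le_div ha]) one_lt_two
    rw [le_div_iff₀ ha] at hk1
    rw [div_lt_iff₀ ha] at hk2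
    refine ⟨k, by rwa [mem_ball, dist_comm], ENNReal.ofReal_le_ofReal ?_⟩
    exact Real.rpow_le_rpow_of_nonpos (by positivity) hk1
      (by have : (0 : ℝ) ≤ d := Nat.cast_nonneg d
          linarith)
  · intro k
    rw [volume_ball_eq x (by positivity), ← ENNReal.ofReal_mul (by positivity)]
    refine ENNReal.ofReal_le_ofReal (le_of_eq ?_)
    have h2 : (0 : ℝ) < 2 ^ k := by positivity
    rw [pow_succ, Real.mul_rpow h2.le ha.le, Real.mul_rpow (by positivity) ha.le,
      Real.mul_rpow h2.le two_pos.le, ← Real.rpow_natCast 2 k, ← Real.rpow_natCast (2 ^ (_ : ℝ)) k,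
      ← Real.rpow_mul two_pos.le, ← Real.rpow_mul two_pos.le, ← Real.rpow_mul two_pos.le,
      sub_eq_add_neg, Real.rpow_add ha, add_mul, Real.rpow_add two_pos, mul_comm (k : ℝ) (-m),
      mul_comm (k : ℝ) (d : ℝ)]
    ring

end Balls

section Domain

variable {d : ℕ} {Ω : Set (Rd d)}

lemma distBd_nonneg (x : Rd d) : 0 ≤ distBd Ω x := infDist_nonneg

@[fun_prop]
lemma continuous_distBd : Continuous (distBd Ω) := continuous_infDist_pt _

@[fun_prop]
lemma measurable_distBd : Measurable (distBd Ω) := continuous_distBd.measurable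

lemma distBd_le_add (x y : Rd d) : distBd Ω x ≤ distBd Ω y + dist x y :=
  infDist_le_infDist_add_dist

lemma distBd_pos (hopen : IsOpen Ω) (hE : (frontier Ω).Nonempty) {x : Rd d} (hx : x ∈ Ω) :
    0 < distBd Ω x := by
  refine (isClosed_frontier.notMem_iff_infDist_pos hE).1 fun h => ?_
  rw [hopen.frontier_eq] at h
  exact h.2 hx

lemma ball_subset_of_le_distBd (hopen : IsOpen Ω) {x : Rd d} (hx : x ∈ Ω) {r : ℝ} (hr : 0 < r)
    (hrd : r ≤ distBd Ω x) : ball x r ⊆ Ω := by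
  refine (convex_ball x r).isPreconnected.subset_left_of_subset_union hopen
    isClosed_closure.isOpen_compl
    (disjoint_compl_right.mono_right (compl_subset_compl.2 subset_closure)) ?_
    ⟨x, mem_ball_self hr, hx⟩
  intro y hy
  by_contra hcon
  simp only [mem_union, mem_compl_iff, not_or, not_not] at hcon
  have hyE : y ∈ frontier Ω := by
    rw [hopen.frontier_eq]
    exact ⟨hcon.2, hcon.1⟩
  have h1 : distBd Ω x ≤ dist x y := infDist_le_dist_of_mem hyE
  rw [mem_ball, dist_comm] at hy
  linarith

/-- Uniform domains satisfy the measure density condition. -/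
lemma exists_le_volume_inter_ball (hopen : IsOpen Ω) (hunif : IsUniformDomain Ω) :
    ∃ c : ℝ, 0 < c ∧ ∀ x ∈ Ω, ∀ y ∈ Ω, ∀ t : ℝ, 0 < t → t ≤ dist x y →
      ENNReal.ofReal (c * t ^ (d : ℝ)) ≤ volume (Ω ∩ ball x t) := by
  obtain ⟨C, hC, h⟩ := hunif
  have hC0 : 0 < C := by linarith
  have hv := unitBallVol_pos d
  refine ⟨((2 * C)⁻¹) ^ (d : ℝ) * unitBallVol d, by positivity, ?_⟩
  intro x hx y hy t ht hty
  obtain ⟨l, γ, hl, -, h0, h1, hmem, hlip, hdist⟩ := h x hx y hy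
  have hcont : ContinuousOn (fun u => dist (γ u) x) (Icc 0 l) :=
    (continuous_id.dist continuous_const).comp_continuousOn hlip.continuousOn
  have hmemt : t / 2 ∈ Icc (dist (γ 0) x) (dist (γ l) x) := by
    rw [h0, h1, dist_self, dist_comm y x]
    constructor <;> linarith
  obtain ⟨u, hu, hut⟩ := intermediate_value_Icc hl hcont hmemt
  simp only at hut
  have hzy : t / 2 ≤ dist (γ u) y := by
    have := dist_triangle_left x y (γ u)
    linarith
  have hd : t / 2 / C ≤ distBd Ω (γ u) := by
    refine le_trans ?_ (hdist u hu)
    gcongr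
    exact le_min hut.ge hzy
  have hr : 0 < t / 2 / C := by positivity
  have hrt : t / 2 / C ≤ t / 2 := div_le_self (by positivity) hC
  calc ENNReal.ofReal (((2 * C)⁻¹) ^ (d : ℝ) * unitBallVol d * t ^ (d : ℝ))
      = volume (ball (γ u) (t / 2 / C)) := by
        rw [volume_ball_eq _ hr]
        congr 1
        rw [show t / 2 / C = (2 * C)⁻¹ * t by field_simp, Real.mul_rpow (by positivity) ht.le]
        ring
    _ ≤ volume (Ω ∩ ball x t) := by
        refine measure_mono (subset_inter (ball_subset_of_le_distBd hopen (hmem u hu) hr hd) ?_)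
        refine ball_subset_ball' ?_
        linarith

end Domain

section Weight

variable {d : ℕ} {Ω : Set (Rd d)}

lemma mem_cthickening_of_infDist_le {E : Set (Rd d)} (hE : E.Nonempty) {x : Rd d} {r : ℝ}
    (h : infDist x E ≤ r) : x ∈ cthickening r E := by
  rw [mem_cthickening_iff, ← ENNReal.ofReal_toReal (infEDist_ne_top hE)]
  exact ENNReal.ofReal_le_ofReal h

/-- A positive lower Assouad codimension forces the set to have positive diameter. -/
lemma ediam_pos_of_lowerCodimA_pos {E : Set (Rd d)} (h : 0 < lowerCodimA E) :
    0 < Metric.ediam E := by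
  rw [pos_iff_ne_zero]
  intro h0
  have hset : lowerCodimSet E = Ici 0 := by
    ext q
    refine ⟨fun hq => hq.1, fun hq => ⟨hq, 1, le_rfl, ?_⟩⟩
    intro x _ r R _ _ hR
    exact absurd (hR.trans_eq h0) not_lt_zero
  rw [lowerCodimA, hset, Real.sSup_of_not_bddAbove (not_bddAbove_Ici 0)] at h
  exact lt_irrefl _ h

/-- Local integrability of negative powers of the distance, at small scales and around boundary
points. -/
lemma exists_setLIntegral_distBd_le_of_lt_ediam {q γ : ℝ} (hγ : 0 ≤ γ) (hγq : γ < q)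
    (hopen : IsOpen Ω) (hq : q ∈ lowerCodimSet (frontier Ω)) :
    ∃ C : ℝ, 0 < C ∧ ∀ w ∈ frontier Ω, ∀ R : ℝ, 0 < R →
      ENNReal.ofReal R < Metric.ediam (frontier Ω) →
      ∫⁻ x in Ω ∩ ball w R, ENNReal.ofReal (distBd Ω x ^ (-γ))
        ≤ ENNReal.ofReal (C * (R ^ (d : ℝ) * R ^ (-γ))) := by
  obtain ⟨-, C, hC, hCov⟩ := hq
  have hC0 : 0 < C := by linarith
  have hθ : (2 : ℝ) ^ (γ - q) < 1 :=
    Real.rpow_lt_one_of_one_lt_of_neg one_lt_two (by linarith)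
  have hθ' : 0 < 1 - (2 : ℝ) ^ (γ - q) := by linarith
  have hv := unitBallVol_pos d
  refine ⟨2 ^ γ * C * unitBallVol d / (1 - 2 ^ (γ - q)), by positivity, ?_⟩
  intro w hw R hR hRE
  have hE : (frontier Ω).Nonempty := ⟨w, hw⟩
  have key := setLIntegral_le_of_geometric_cover (μ := (volume : Measure (Rd d)))
    (S := Ω ∩ ball w R) (hopen.measurableSet.inter measurableSet_ball)
    (φ := fun x => ENNReal.ofReal (distBd Ω x ^ (-γ)))
    (A := fun k => cthickening ((2⁻¹ : ℝ) ^ k * R) (frontier Ω) ∩ ball w R)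
    (fun k => isClosed_cthickening.measurableSet.inter measurableSet_ball)
    (c := fun k => ENNReal.ofReal (((2⁻¹ : ℝ) ^ (k + 1) * R) ^ (-γ)))
    (B := 2 ^ γ * C * unitBallVol d * (R ^ (d : ℝ) * R ^ (-γ))) (θ := 2 ^ (γ - q))
    ?_ (by positivity) (by positivity) hθ ?_
  · refine key.trans (ENNReal.ofReal_le_ofReal (le_of_eq ?_))
    ring
  · rintro x ⟨hxΩ, hxw⟩
    have hx0 := distBd_pos hopen hE hxΩ
    have hxR : distBd Ω x ≤ R := (infDist_le_dist_of_mem hw).trans (mem_ball.1 hxw).le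
    obtain ⟨k, hk1, hk2⟩ := exists_nat_pow_near_of_lt_one (x := distBd Ω x / R)
      (y := (2⁻¹ : ℝ)) (by positivity) (by rwa [div_le_one hR]) (by norm_num) (by norm_num)
    rw [lt_div_iff₀ hR] at hk1
    rw [div_le_iff₀ hR] at hk2
    refine ⟨k, ⟨mem_cthickening_of_infDist_le hE hk2, hxw⟩, ENNReal.ofReal_le_ofReal ?_⟩
    exact Real.rpow_le_rpow_of_nonpos (by positivity) hk1.le (by linarith)
  · intro k
    have hvol : volume (cthickening ((2⁻¹ : ℝ) ^ k * R) (frontier Ω) ∩ ball w R)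
        ≤ ENNReal.ofReal (C * ((2⁻¹ : ℝ) ^ k) ^ q) * volume (ball w R) := by
      rcases Nat.eq_zero_or_pos k with rfl | hk
      · refine (measure_mono inter_subset_right).trans ?_
        refine le_mul_of_one_le_left zero_le ?_
        simpa using hC
      · have hlt : (2⁻¹ : ℝ) ^ k < 1 := pow_lt_one₀ (by norm_num) (by norm_num) hk.ne'
        have := hCov w hw ((2⁻¹ : ℝ) ^ k * R) R (by positivity)
          (mul_lt_of_lt_one_left hR hlt) hRE
        rwa [mul_div_cancel_right₀ _ hR.ne'] at this
    refine (mul_le_mul_right hvol _).trans ?_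
    rw [volume_ball_eq w hR, ← ENNReal.ofReal_mul (by positivity),
      ← ENNReal.ofReal_mul (by positivity)]
    refine ENNReal.ofReal_le_ofReal (le_of_eq ?_)
    have e1 : ((2⁻¹ : ℝ) ^ (k + 1)) ^ (-γ) = 2 ^ γ * 2 ^ (γ * k) := by
      rw [inv_pow, Real.inv_rpow (by positivity), Real.rpow_neg (by positivity), inv_inv,
        ← Real.rpow_natCast 2 (k + 1), ← Real.rpow_mul two_pos.le, ← Real.rpow_add two_pos]
      push_cast
      ring_nf
    have e2 : ((2⁻¹ : ℝ) ^ k) ^ q = 2 ^ (-q * k) := by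
      rw [inv_pow, Real.inv_rpow (by positivity), ← Real.rpow_neg (by positivity),
        ← Real.rpow_natCast 2 k, ← Real.rpow_mul two_pos.le]
      ring_nf
    have e3 : ((2 : ℝ) ^ (γ - q)) ^ k = 2 ^ (γ * k) * 2 ^ (-q * k) := by
      rw [← Real.rpow_natCast (2 ^ (γ - q)) k, ← Real.rpow_mul two_pos.le,
        ← Real.rpow_add two_pos]
      ring_nf
    rw [Real.mul_rpow (by positivity) hR.le, e1, e2, e3]
    ring

lemma setLIntegral_distBd_lt_top {q γ : ℝ} (hγ : 0 ≤ γ) (hγq : γ < q)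
    (hopen : IsOpen Ω) (hbdd : Bornology.IsBounded Ω) (hE : (frontier Ω).Nonempty)
    (hdiam : 0 < Metric.ediam (frontier Ω)) (hq : q ∈ lowerCodimSet (frontier Ω)) :
    ∫⁻ x in Ω, ENNReal.ofReal (distBd Ω x ^ (-γ)) < ⊤ := by
  obtain ⟨C, -, hC⟩ := exists_setLIntegral_distBd_le_of_lt_ediam hγ hγq hopen hq
  have hcomp : IsCompact (closure Ω) := hbdd.isCompact_closure
  let μ : Measure (Rd d) :=
    (volume.restrict Ω).withDensity fun x => ENNReal.ofReal (distBd Ω x ^ (-γ))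
  have hball : ∀ x r, μ (ball x r) =
      ∫⁻ x in Ω ∩ ball x r, ENNReal.ofReal (distBd Ω x ^ (-γ)) := by
    intro x r
    rw [withDensity_apply _ measurableSet_ball, Measure.restrict_restrict measurableSet_ball,
      inter_comm]
  have hfin : μ (closure Ω) < ⊤ := by
    refine hcomp.measure_lt_top_of_nhdsWithin fun x hx => ?_
    by_cases hxΩ : x ∈ Ω
    · have hx0 := distBd_pos hopen hE hxΩ
      refine ⟨ball x (distBd Ω x / 2),
        mem_nhdsWithin_of_mem_nhds (ball_mem_nhds x (by positivity)), ?_⟩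
      rw [hball]
      calc ∫⁻ y in Ω ∩ ball x (distBd Ω x / 2), ENNReal.ofReal (distBd Ω y ^ (-γ))
          ≤ ∫⁻ _ in Ω ∩ ball x (distBd Ω x / 2), ENNReal.ofReal ((distBd Ω x / 2) ^ (-γ)) := by
            refine setLIntegral_mono' (hopen.measurableSet.inter measurableSet_ball) ?_
            rintro y ⟨-, hy⟩
            refine ENNReal.ofReal_le_ofReal
              (Real.rpow_le_rpow_of_nonpos (by positivity) ?_ (by linarith))
            have h1 := distBd_le_add (Ω := Ω) x y
            rw [mem_ball, dist_comm] at hy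
            linarith
        _ < ⊤ := by
            rw [setLIntegral_const]
            exact ENNReal.mul_lt_top ENNReal.ofReal_lt_top
              ((measure_mono inter_subset_right).trans_lt measure_ball_lt_top)
    · have hxE : x ∈ frontier Ω := by
        rw [hopen.frontier_eq]
        exact ⟨hx, hxΩ⟩
      obtain ⟨R, hR0, hR⟩ := ENNReal.lt_iff_exists_real_btwn.1 hdiam
      have hRpos : 0 < R := by
        simpa using hR.1
      refine ⟨ball x R, mem_nhdsWithin_of_mem_nhds (ball_mem_nhds x hRpos), ?_⟩
      rw [hball]
      exact (hC x hxE R hRpos hR.2).trans_lt ENNReal.ofReal_lt_top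
  have huniv : μ (closure Ω) = ∫⁻ x in Ω, ENNReal.ofReal (distBd Ω x ^ (-γ)) := by
    rw [withDensity_apply _ isClosed_closure.measurableSet,
      Measure.restrict_restrict isClosed_closure.measurableSet,
      inter_eq_self_of_subset_right subset_closure]
  exact huniv ▸ hfin

/-- The weight `d_Ω^{-γ}` satisfies an `A₁`-type condition on balls centred in `Ω`. -/
lemma exists_setLIntegral_distBd_le {q γ : ℝ} (hγ : 0 ≤ γ) (hγq : γ < q)
    (hopen : IsOpen Ω) (hbdd : Bornology.IsBounded Ω) (hE : (frontier Ω).Nonempty)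
    (hdiam : 0 < Metric.ediam (frontier Ω)) (hq : q ∈ lowerCodimSet (frontier Ω)) (M : ℝ) :
    ∃ C : ℝ, 0 < C ∧ ∀ z ∈ Ω, ∀ R : ℝ, 0 < R → R ≤ M →
      ∫⁻ x in Ω ∩ ball z R, ENNReal.ofReal (distBd Ω x ^ (-γ))
        ≤ ENNReal.ofReal (C * (R ^ (d : ℝ) * (distBd Ω z + R) ^ (-γ))) := by
  obtain ⟨C₀, hC₀, hC⟩ := exists_setLIntegral_distBd_le_of_lt_ediam hγ hγq hopen hq
  have hI := setLIntegral_distBd_lt_top hγ hγq hopen hbdd hE hdiam hq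
  set I := ∫⁻ x in Ω, ENNReal.ofReal (distBd Ω x ^ (-γ)) with hIdef
  have hEbdd : Bornology.IsBounded (frontier Ω) := hbdd.closure.subset frontier_subset_closure
  have hDtop : Metric.ediam (frontier Ω) ≠ ⊤ := hEbdd.ediam_ne_top
  set D := (Metric.ediam (frontier Ω)).toReal with hD
  have hD0 : 0 < D := ENNReal.toReal_pos hdiam.ne' hDtop
  have hv := unitBallVol_pos d
  have hI0 : 0 ≤ I.toReal := ENNReal.toReal_nonneg
  rcases le_or_gt M 0 with hM | hM
  · exact ⟨1, one_pos, fun z _ R hR hRM => absurd (hR.trans_le hRM) hM.not_gt⟩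
  set C₁ := I.toReal * (D ^ (d : ℝ) * (3 * M) ^ (-γ))⁻¹ with hC₁
  have hC₁0 : 0 ≤ C₁ := by positivity
  have hbd : ∀ w ∈ frontier Ω, ∀ T : ℝ, 0 < T → T ≤ 3 * M →
      ∫⁻ x in Ω ∩ ball w T, ENNReal.ofReal (distBd Ω x ^ (-γ))
        ≤ ENNReal.ofReal ((C₀ + C₁) * (T ^ (d : ℝ) * T ^ (-γ))) := by
    intro w hw T hT hTM
    rcases lt_or_ge T D with hTD | hTD
    · refine (hC w hw T hT ?_).trans (ENNReal.ofReal_le_ofReal ?_)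
      · rw [← ENNReal.ofReal_toReal hDtop]
        exact (ENNReal.ofReal_lt_ofReal_iff hD0).2 hTD
      · gcongr
        linarith
    · calc ∫⁻ x in Ω ∩ ball w T, ENNReal.ofReal (distBd Ω x ^ (-γ))
          ≤ I := lintegral_mono_set inter_subset_left
        _ = ENNReal.ofReal I.toReal := (ENNReal.ofReal_toReal hI.ne).symm
        _ ≤ ENNReal.ofReal ((C₀ + C₁) * (T ^ (d : ℝ) * T ^ (-γ))) := by
            refine ENNReal.ofReal_le_ofReal ?_
            calc I.toReal = C₁ * (D ^ (d : ℝ) * (3 * M) ^ (-γ)) := by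
                  rw [hC₁, inv_mul_cancel_right₀ (by positivity)]
              _ ≤ (C₀ + C₁) * (T ^ (d : ℝ) * T ^ (-γ)) := by
                  have h1 : (3 * M) ^ (-γ) ≤ T ^ (-γ) :=
                    Real.rpow_le_rpow_of_nonpos hT hTM (by linarith)
                  gcongr
                  linarith
  refine ⟨(C₀ + C₁) * 3 ^ (d : ℝ) + 3 ^ γ * unitBallVol d, by positivity, ?_⟩
  intro z hz R hR hRM
  have hz0 := distBd_pos hopen hE hz
  have hpos : 0 < distBd Ω z + R := by positivity
  rcases le_or_gt R (distBd Ω z / 2) with hsmall | hlarge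
  · calc ∫⁻ x in Ω ∩ ball z R, ENNReal.ofReal (distBd Ω x ^ (-γ))
        ≤ ∫⁻ _ in Ω ∩ ball z R, ENNReal.ofReal (((distBd Ω z + R) / 3) ^ (-γ)) := by
          refine setLIntegral_mono' (hopen.measurableSet.inter measurableSet_ball) ?_
          rintro y ⟨-, hy⟩
          refine ENNReal.ofReal_le_ofReal
            (Real.rpow_le_rpow_of_nonpos (by positivity) ?_ (by linarith))
          have h1 := distBd_le_add (Ω := Ω) z y
          rw [mem_ball, dist_comm] at hy
          linarith
      _ ≤ ENNReal.ofReal (((distBd Ω z + R) / 3) ^ (-γ)) * volume (ball z R) := by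
          rw [setLIntegral_const]
          gcongr
          exact inter_subset_right
      _ ≤ _ := by
          rw [volume_ball_eq z hR, ← ENNReal.ofReal_mul (by positivity)]
          refine ENNReal.ofReal_le_ofReal ?_
          have e : ((distBd Ω z + R) / 3) ^ (-γ) = 3 ^ γ * (distBd Ω z + R) ^ (-γ) := by
            rw [Real.div_rpow hpos.le (by norm_num), Real.rpow_neg (by norm_num : (0 : ℝ) ≤ 3),
              div_inv_eq_mul, mul_comm]
          rw [e]
          have : 0 ≤ (C₀ + C₁) * 3 ^ (d : ℝ) * (R ^ (d : ℝ) * (distBd Ω z + R) ^ (-γ)) := by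
            positivity
          linarith
  · obtain ⟨w, hw, hwz⟩ := (hEbdd.isCompact_closure).exists_infDist_eq_dist hE.closure z
    rw [infDist_closure] at hwz
    rw [isClosed_frontier.closure_eq] at hw
    calc ∫⁻ x in Ω ∩ ball z R, ENNReal.ofReal (distBd Ω x ^ (-γ))
        ≤ ∫⁻ x in Ω ∩ ball w (3 * R), ENNReal.ofReal (distBd Ω x ^ (-γ)) := by
          refine lintegral_mono_set (inter_subset_inter_right _ (ball_subset_ball' ?_))
          rw [← hwz]
          change R + distBd Ω z ≤ _
          linarith
      _ ≤ ENNReal.ofReal ((C₀ + C₁) * ((3 * R) ^ (d : ℝ) * (3 * R) ^ (-γ))) :=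
          hbd w hw _ (by positivity) (by linarith)
      _ ≤ _ := by
          refine ENNReal.ofReal_le_ofReal ?_
          have h1 : (3 * R) ^ (-γ) ≤ (distBd Ω z + R) ^ (-γ) :=
            Real.rpow_le_rpow_of_nonpos hpos (by linarith) (by linarith)
          calc (C₀ + C₁) * ((3 * R) ^ (d : ℝ) * (3 * R) ^ (-γ))
              ≤ (C₀ + C₁) * ((3 * R) ^ (d : ℝ) * (distBd Ω z + R) ^ (-γ)) := by gcongr
            _ = (C₀ + C₁) * 3 ^ (d : ℝ) * (R ^ (d : ℝ) * (distBd Ω z + R) ^ (-γ)) := by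
                rw [Real.mul_rpow (by norm_num) hR.le]
                ring
            _ ≤ _ := by
                gcongr
                have : 0 < 3 ^ γ * unitBallVol d := by positivity
                linarith

end Weight

section Kernels

variable {d : ℕ}

/-- The `p`-th power of the increment of `f`. -/
noncomputable def incrPow (p : ℝ) (f : Rd d → ℝ) (x y : Rd d) : ℝ≥0∞ :=
  ENNReal.ofReal (|f x - f y| ^ p)

/-- The kernel `|x - y|^{-m}`. -/
noncomputable def distPow (m : ℝ) (x y : Rd d) : ℝ≥0∞ := ENNReal.ofReal (dist x y ^ (-m))

/-- The weight `d_Ω(x)^{-a}`. -/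
noncomputable def bdPow (Ω : Set (Rd d)) (a : ℝ) (x : Rd d) : ℝ≥0∞ :=
  ENNReal.ofReal (distBd Ω x ^ (-a))

open Classical in
/-- The indicator of `|z - x| < ε |x - y|`. -/
noncomputable def nearInd (ε : ℝ) (x y z : Rd d) : ℝ≥0∞ :=
  if dist z x < ε * dist x y then 1 else 0

variable {X : Type*} [MeasurableSpace X]

@[fun_prop]
lemma Measurable.incrPow {p : ℝ} {f : Rd d → ℝ} (hf : Measurable f) {a b : X → Rd d}
    (ha : Measurable a) (hb : Measurable b) : Measurable fun t => incrPow p f (a t) (b t) := by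
  have h : Measurable fun t => |f (a t) - f (b t)| := by
    simpa only [Real.norm_eq_abs, Pi.sub_apply, Function.comp_apply] using
      ((hf.comp ha).sub (hf.comp hb)).norm
  exact (h.pow_const p).ennreal_ofReal

@[fun_prop]
lemma Measurable.distPow {m : ℝ} {a b : X → Rd d}
    (ha : Measurable a) (hb : Measurable b) : Measurable fun t => distPow m (a t) (b t) :=
  ((ha.dist hb).pow_const _).ennreal_ofReal

@[fun_prop]
lemma Measurable.bdPow {Ω : Set (Rd d)} {c : ℝ} {a : X → Rd d} (ha : Measurable a) :
    Measurable fun t => bdPow Ω c (a t) :=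
  ((measurable_distBd.comp ha).pow_const _).ennreal_ofReal

@[fun_prop]
lemma Measurable.nearInd {ε : ℝ} {a b c : X → Rd d} (ha : Measurable a) (hb : Measurable b)
    (hc : Measurable c) : Measurable fun t => nearInd ε (a t) (b t) (c t) :=
  Measurable.ite (measurableSet_lt (hc.dist ha) ((ha.dist hb).const_mul ε))
    measurable_const measurable_const

lemma incrPow_comm (p : ℝ) (f : Rd d → ℝ) (x y : Rd d) : incrPow p f x y = incrPow p f y x := by
  rw [incrPow, incrPow, abs_sub_comm]

lemma distPow_comm (m : ℝ) (x y : Rd d) : distPow m x y = distPow m y x := by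
  rw [distPow, distPow, dist_comm]

lemma incrPow_self {p : ℝ} (hp : 1 ≤ p) (f : Rd d → ℝ) (x : Rd d) : incrPow p f x x = 0 := by
  simp [incrPow, Real.zero_rpow (by linarith : p ≠ 0)]

lemma incrPow_le {p : ℝ} (hp : 1 ≤ p) (f : Rd d → ℝ) (x y z : Rd d) :
    incrPow p f x y ≤ ENNReal.ofReal (2 ^ p) * (incrPow p f x z + incrPow p f z y) := by
  have hp0 : 0 ≤ p := by linarith
  rw [incrPow, incrPow, incrPow, ← ENNReal.ofReal_add (by positivity) (by positivity),
    ← ENNReal.ofReal_mul (by positivity)]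
  refine ENNReal.ofReal_le_ofReal ?_
  set a := |f x - f z|
  set b := |f z - f y|
  have ha : 0 ≤ a := abs_nonneg _
  have hb : 0 ≤ b := abs_nonneg _
  have htri : |f x - f y| ≤ 2 * max a b := by
    have := abs_sub_le (f x) (f z) (f y)
    have h1 := le_max_left a b
    have h2 := le_max_right a b
    linarith
  calc |f x - f y| ^ p ≤ (2 * max a b) ^ p := by gcongr
    _ = 2 ^ p * (max a b) ^ p := Real.mul_rpow two_pos.le (by positivity)
    _ ≤ 2 ^ p * (a ^ p + b ^ p) := by
        gcongr
        rcases max_cases a b with ⟨h, -⟩ | ⟨h, -⟩ <;> rw [h]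
        · exact le_add_of_nonneg_right (by positivity)
        · exact le_add_of_nonneg_left (by positivity)

lemma gagP_eq (Ω : Set (Rd d)) (s p α β : ℝ) (f : Rd d → ℝ) :
    gagP Ω s p α β f = ∫⁻ x in Ω, ∫⁻ y in Ω,
      incrPow p f x y * distPow ((d : ℝ) + s * p) x y * bdPow Ω β y * bdPow Ω α x := by
  have h0 : ∀ x : Rd d, 0 ≤ distBd Ω x := distBd_nonneg
  refine lintegral_congr fun x => lintegral_congr fun y => ?_
  have := h0 x
  have := h0 y
  rw [incrPow, distPow, bdPow, bdPow, ← ENNReal.ofReal_mul (by positivity),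
    ← ENNReal.ofReal_mul (by positivity), ← ENNReal.ofReal_mul (by positivity),
    Real.rpow_neg dist_nonneg, div_eq_mul_inv]

lemma bdPow_zero (Ω : Set (Rd d)) (x : Rd d) : bdPow Ω 0 x = 1 := by
  simp [bdPow]

lemma gagP_zero_eq {Ω : Set (Rd d)} {s p γ : ℝ} {f : Rd d → ℝ} (hf : Measurable f) :
    gagP Ω s p γ 0 f = ∫⁻ x in Ω,
      (∫⁻ y in Ω, incrPow p f x y * distPow ((d : ℝ) + s * p) x y) * bdPow Ω γ x := by
  rw [gagP_eq]
  refine lintegral_congr fun x => ?_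
  simp only [bdPow_zero, mul_one]
  exact lintegral_mul_const _ (by fun_prop)

lemma gagP_congr_ae {Ω : Set (Rd d)} {s p α β : ℝ} {f g : Rd d → ℝ}
    (h : f =ᵐ[volume.restrict Ω] g) : gagP Ω s p α β f = gagP Ω s p α β g := by
  refine lintegral_congr_ae (h.mono fun x hx => lintegral_congr_ae (h.mono fun y hy => ?_))
  simp only [hx, hy]

lemma bdPow_mul_bdPow_le {Ω : Set (Rd d)} {α β : ℝ} (hα : 0 ≤ α) (hβ : 0 ≤ β) {x y : Rd d}
    (hx : 0 < distBd Ω x) (hy : 0 < distBd Ω y) :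
    bdPow Ω β y * bdPow Ω α x ≤ bdPow Ω (α + β) x + bdPow Ω (α + β) y := by
  rw [bdPow, bdPow, bdPow, bdPow, ← ENNReal.ofReal_mul (by positivity),
    ← ENNReal.ofReal_add (by positivity) (by positivity), neg_add, Real.rpow_add hx,
    Real.rpow_add hy]
  refine ENNReal.ofReal_le_ofReal ?_
  rcases le_total (distBd Ω x) (distBd Ω y) with h | h
  · have h1 : distBd Ω y ^ (-β) ≤ distBd Ω x ^ (-β) :=
      Real.rpow_le_rpow_of_nonpos hx h (by linarith)
    have h2 : distBd Ω y ^ (-β) * distBd Ω x ^ (-α) ≤ distBd Ω x ^ (-β) * distBd Ω x ^ (-α) := by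
      gcongr
    have h3 : 0 ≤ distBd Ω y ^ (-α) * distBd Ω y ^ (-β) := by positivity
    linarith
  · have h1 : distBd Ω x ^ (-α) ≤ distBd Ω y ^ (-α) :=
      Real.rpow_le_rpow_of_nonpos hy h (by linarith)
    have h2 : distBd Ω y ^ (-β) * distBd Ω x ^ (-α) ≤ distBd Ω y ^ (-β) * distBd Ω y ^ (-α) := by
      gcongr
    have h3 : 0 ≤ distBd Ω x ^ (-α) * distBd Ω x ^ (-β) := by positivity
    linarith

lemma gagP_le_two_mul {Ω : Set (Rd d)} (hopen : IsOpen Ω) (hE : (frontier Ω).Nonempty)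
    {s p α β : ℝ} (hα : 0 ≤ α) (hβ : 0 ≤ β) {f : Rd d → ℝ} (hf : Measurable f) :
    gagP Ω s p α β f ≤ 2 * gagP Ω s p (α + β) 0 f := by
  set m := (d : ℝ) + s * p with hm
  have hsymm : ∫⁻ x in Ω, ∫⁻ y in Ω, incrPow p f x y * distPow m x y * bdPow Ω (α + β) y
      = ∫⁻ x in Ω, ∫⁻ y in Ω, incrPow p f x y * distPow m x y * bdPow Ω (α + β) x := by
    rw [lintegral_lintegral_swap (by unfold Function.uncurry; fun_prop)]
    refine lintegral_congr fun x => lintegral_congr fun y => ?_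
    rw [incrPow_comm, distPow_comm]
  calc gagP Ω s p α β f
      ≤ ∫⁻ x in Ω, ∫⁻ y in Ω, (incrPow p f x y * distPow m x y * bdPow Ω (α + β) x
          + incrPow p f x y * distPow m x y * bdPow Ω (α + β) y) := by
        rw [gagP_eq]
        refine setLIntegral_mono' hopen.measurableSet fun x hx =>
          setLIntegral_mono' hopen.measurableSet fun y hy => ?_
        rw [← mul_add, mul_assoc (_ * _)]
        gcongr
        exact bdPow_mul_bdPow_le hα hβ (distBd_pos hopen hE hx) (distBd_pos hopen hE hy)
    _ = 2 * gagP Ω s p (α + β) 0 f := by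
        rw [gagP_eq, two_mul]
        simp only [bdPow_zero, mul_one]
        conv_rhs => enter [2]; rw [← hsymm]
        rw [← lintegral_add_left (by fun_prop)]
        exact lintegral_congr fun x => lintegral_add_left (by fun_prop) _

end Kernels

section Comparison

variable {d : ℕ} {Ω : Set (Rd d)}

lemma setLIntegral_nearInd (ε : ℝ) (x y : Rd d) :
    ∫⁻ z in Ω, nearInd ε x y z = volume (Ω ∩ ball x (ε * dist x y)) := by
  have h : (fun z => nearInd ε x y z) = (ball x (ε * dist x y)).indicator 1 := by
    ext z
    simp [nearInd, indicator, mem_ball]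
  rw [h, lintegral_indicator_one measurableSet_ball, Measure.restrict_apply measurableSet_ball,
    inter_comm]

/-- Averaging the triangle inequality over intermediate points close to `x`. -/
lemma incrPow_mul_distPow_le {c : ℝ} (hc : 0 < c)
    (hdens : ∀ x ∈ Ω, ∀ y ∈ Ω, ∀ t : ℝ, 0 < t → t ≤ dist x y →
      ENNReal.ofReal (c * t ^ (d : ℝ)) ≤ volume (Ω ∩ ball x t))
    {p m ε : ℝ} (hp : 1 ≤ p) (hε : 0 < ε) (hε1 : ε ≤ 1) {f : Rd d → ℝ} (hf : Measurable f)
    {x y : Rd d} (hx : x ∈ Ω) (hy : y ∈ Ω) :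
    incrPow p f x y * distPow m x y ≤ ENNReal.ofReal (2 ^ p / c * ε ^ (-(d : ℝ))) *
      ((∫⁻ z in Ω, nearInd ε x y z * distPow (d + m) x y * incrPow p f x z)
        + ∫⁻ z in Ω, nearInd ε x y z * distPow (d + m) x y * incrPow p f z y) := by
  rcases eq_or_ne x y with rfl | hxy
  · simp [incrPow_self hp]
  have hr : 0 < dist x y := dist_pos.2 hxy
  set r := dist x y with hrdef
  have hvol : incrPow p f x y * ENNReal.ofReal (c * (ε * r) ^ (d : ℝ)) ≤
      ENNReal.ofReal (2 ^ p) *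
        ∫⁻ z in Ω, nearInd ε x y z * (incrPow p f x z + incrPow p f z y) := by
    calc incrPow p f x y * ENNReal.ofReal (c * (ε * r) ^ (d : ℝ))
        ≤ incrPow p f x y * ∫⁻ z in Ω, nearInd ε x y z := by
          rw [setLIntegral_nearInd]
          gcongr
          exact hdens x hx y hy _ (by positivity) (mul_le_of_le_one_left hr.le hε1)
      _ = ∫⁻ z in Ω, incrPow p f x y * nearInd ε x y z :=
          (lintegral_const_mul _ (by fun_prop)).symm
      _ ≤ ∫⁻ z in Ω, ENNReal.ofReal (2 ^ p) *
            (nearInd ε x y z * (incrPow p f x z + incrPow p f z y)) := by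
          refine lintegral_mono fun z => ?_
          calc incrPow p f x y * nearInd ε x y z
              ≤ ENNReal.ofReal (2 ^ p) * (incrPow p f x z + incrPow p f z y)
                * nearInd ε x y z := by
                gcongr
                exact incrPow_le hp f x y z
            _ = _ := by ring
      _ = _ := lintegral_const_mul _ (by fun_prop)
  have hJ : distPow m x y = ENNReal.ofReal (c * (ε * r) ^ (d : ℝ)) *
      (ENNReal.ofReal (c⁻¹ * ε ^ (-(d : ℝ))) * distPow (d + m) x y) := by
    rw [distPow, distPow, ← ENNReal.ofReal_mul (by positivity),
      ← ENNReal.ofReal_mul (by positivity), ← hrdef, Real.mul_rpow hε.le hr.le, neg_add,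
      Real.rpow_add hr, Real.rpow_neg hε.le, Real.rpow_neg hr.le (d : ℝ)]
    congr 1
    field_simp
  calc incrPow p f x y * distPow m x y
      = incrPow p f x y * ENNReal.ofReal (c * (ε * r) ^ (d : ℝ)) *
        (ENNReal.ofReal (c⁻¹ * ε ^ (-(d : ℝ))) * distPow (d + m) x y) := by
        rw [hJ, mul_assoc]
    _ ≤ ENNReal.ofReal (2 ^ p) *
        (∫⁻ z in Ω, nearInd ε x y z * (incrPow p f x z + incrPow p f z y)) *
        (ENNReal.ofReal (c⁻¹ * ε ^ (-(d : ℝ))) * distPow (d + m) x y) := by gcongr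
    _ = ENNReal.ofReal (2 ^ p / c * ε ^ (-(d : ℝ))) * (distPow (d + m) x y *
        ∫⁻ z in Ω, nearInd ε x y z * (incrPow p f x z + incrPow p f z y)) := by
        rw [show (2 : ℝ) ^ p / c * ε ^ (-(d : ℝ)) = 2 ^ p * (c⁻¹ * ε ^ (-(d : ℝ))) by
          ring, ENNReal.ofReal_mul (p := 2 ^ p) (by positivity)]
        ring
    _ = _ := by
        rw [← lintegral_const_mul _ (by fun_prop), ← lintegral_add_left (by fun_prop)]
        congr 1
        refine lintegral_congr fun z => ?_
        ring

/-- The part of the averaged inequality that can be absorbed. -/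
lemma lintegral_nearInd_mul_incrPow_le {m C ε p : ℝ} (hp : 1 ≤ p) (hε : 0 < ε) (hC : 0 < C)
    (htail : ∀ (x : Rd d) (a : ℝ), 0 < a →
      ∫⁻ y in {y | a ≤ dist x y}, ENNReal.ofReal (dist x y ^ (-((d : ℝ) + m)))
        ≤ ENNReal.ofReal (C * a ^ ((d : ℝ) - (d + m))))
    {f : Rd d → ℝ} (hf : Measurable f) (x : Rd d) :
    ∫⁻ y in Ω, ∫⁻ z in Ω, nearInd ε x y z * distPow (d + m) x y * incrPow p f x z
      ≤ ENNReal.ofReal (C * ε ^ m) * ∫⁻ z in Ω, incrPow p f x z * distPow m x z := by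
  rw [lintegral_lintegral_swap (by unfold Function.uncurry; fun_prop),
    ← lintegral_const_mul _ (by fun_prop)]
  refine lintegral_mono fun z => ?_
  rcases eq_or_ne x z with rfl | hxz
  · simp [incrPow_self hp]
  have hr : 0 < dist x z := dist_pos.2 hxz
  have hS : MeasurableSet {y : Rd d | dist x z / ε ≤ dist x y} :=
    measurableSet_le (by fun_prop) (by fun_prop)
  have h1 : ∫⁻ y in Ω, nearInd ε x y z * distPow (d + m) x y
      ≤ ENNReal.ofReal (C * ε ^ m) * distPow m x z := by
    calc ∫⁻ y in Ω, nearInd ε x y z * distPow (d + m) x y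
        ≤ ∫⁻ y, nearInd ε x y z * distPow (d + m) x y := setLIntegral_le_lintegral _ _
      _ ≤ ∫⁻ y, {y | dist x z / ε ≤ dist x y}.indicator (fun y => distPow (d + m) x y) y := by
          refine lintegral_mono fun y => ?_
          by_cases h : dist z x < ε * dist x y
          · have hy : y ∈ {y : Rd d | dist x z / ε ≤ dist x y} := by
              rw [mem_ofPred_eq, div_le_iff₀' hε, dist_comm x z]
              exact h.le
            simp [nearInd, h, indicator_of_mem hy]
          · simp [nearInd, h]
      _ = ∫⁻ y in {y | dist x z / ε ≤ dist x y},
            ENNReal.ofReal (dist x y ^ (-((d : ℝ) + m))) := lintegral_indicator hS _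
      _ ≤ ENNReal.ofReal (C * (dist x z / ε) ^ ((d : ℝ) - (d + m))) :=
          htail x _ (by positivity)
      _ = ENNReal.ofReal (C * ε ^ m) * distPow m x z := by
          rw [distPow, ← ENNReal.ofReal_mul (by positivity), sub_add_cancel_left,
            Real.div_rpow hr.le hε.le, Real.rpow_neg hε.le, div_inv_eq_mul]
          congr 1
          ring
  calc ∫⁻ y in Ω, nearInd ε x y z * distPow (d + m) x y * incrPow p f x z
      = (∫⁻ y in Ω, nearInd ε x y z * distPow (d + m) x y) * incrPow p f x z :=
        lintegral_mul_const _ (by fun_prop)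
    _ ≤ ENNReal.ofReal (C * ε ^ m) * distPow m x z * incrPow p f x z := by gcongr
    _ = _ := by ring

lemma setLIntegral_bdPow_mul_nearInd_le (hopen : IsOpen Ω) (hE : (frontier Ω).Nonempty)
    {m α β ε C : ℝ} (hm : 0 ≤ m) (hα : 0 ≤ α) (hβ : 0 ≤ β) (hC : 0 < C) (hε : ε ≤ 1 / 2)
    {y z : Rd d} (hy : y ∈ Ω) (hz : z ∈ Ω) (hzy : z ≠ y)
    (hA1 : ∫⁻ x in Ω ∩ ball z (dist z y), ENNReal.ofReal (distBd Ω x ^ (-(α + β)))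
      ≤ ENNReal.ofReal (C * (dist z y ^ (d : ℝ) *
        (distBd Ω z + dist z y) ^ (-(α + β))))) :
    ∫⁻ x in Ω, nearInd ε x y z * distPow (d + m) x y * bdPow Ω (α + β) x
      ≤ ENNReal.ofReal (2 ^ (d + m) * C) *
        (distPow m z y * bdPow Ω β y * bdPow Ω α z) := by
  set R := dist z y with hR
  have hR0 : 0 < R := dist_pos.2 hzy
  have hz0 := distBd_pos hopen hE hz
  have hy0 := distBd_pos hopen hE hy
  have hdm : 0 ≤ (d : ℝ) + m := by positivity
  calc ∫⁻ x in Ω, nearInd ε x y z * distPow (d + m) x y * bdPow Ω (α + β) x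
      ≤ ∫⁻ x in Ω, (ball z R).indicator
          (fun x => ENNReal.ofReal ((R / 2) ^ (-((d : ℝ) + m))) * bdPow Ω (α + β) x) x := by
        refine lintegral_mono fun x => ?_
        by_cases h : dist z x < ε * dist x y
        · have hle : ε * dist x y ≤ 1 / 2 * dist x y := by gcongr
          have t1 := dist_triangle x z y
          have t2 := dist_triangle z x y
          rw [dist_comm x z] at t1
          rw [← hR] at t1 t2
          have hxR : x ∈ ball z R := by
            rw [mem_ball, dist_comm]
            linarith
          simp only [nearInd, h, if_true, one_mul, indicator_of_mem hxR, distPow]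
          gcongr ENNReal.ofReal ?_ * _
          exact Real.rpow_le_rpow_of_nonpos (by positivity) (by linarith) (by linarith)
        · simp [nearInd, h]
    _ = ENNReal.ofReal ((R / 2) ^ (-((d : ℝ) + m))) *
          ∫⁻ x in Ω ∩ ball z R, bdPow Ω (α + β) x := by
        rw [lintegral_indicator measurableSet_ball, Measure.restrict_restrict measurableSet_ball,
          inter_comm, lintegral_const_mul _ (by fun_prop)]
    _ ≤ ENNReal.ofReal ((R / 2) ^ (-((d : ℝ) + m))) *
          ENNReal.ofReal (C * (R ^ (d : ℝ) * (distBd Ω z + R) ^ (-(α + β)))) := by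
        gcongr
        exact hA1
    _ ≤ _ := by
        rw [distPow, bdPow, bdPow, ← ENNReal.ofReal_mul (by positivity),
          ← ENNReal.ofReal_mul (by positivity), ← ENNReal.ofReal_mul (by positivity),
          ← ENNReal.ofReal_mul (by positivity), ← hR]
        refine ENNReal.ofReal_le_ofReal ?_
        have hsum : 0 < distBd Ω z + R := by positivity
        have hyle : distBd Ω y ≤ distBd Ω z + R := by
          have := distBd_le_add (Ω := Ω) y z
          rwa [dist_comm] at this
        have ha : (distBd Ω z + R) ^ (-α) ≤ distBd Ω z ^ (-α) :=
          Real.rpow_le_rpow_of_nonpos hz0 (by linarith) (by linarith)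
        have hb : (distBd Ω z + R) ^ (-β) ≤ distBd Ω y ^ (-β) :=
          Real.rpow_le_rpow_of_nonpos hy0 hyle (by linarith)
        have e1 : (R / 2) ^ (-((d : ℝ) + m)) * R ^ (d : ℝ) = 2 ^ (d + m) * R ^ (-m) := by
          rw [Real.div_rpow hR0.le two_pos.le, Real.rpow_neg two_pos.le, div_inv_eq_mul, neg_add,
            Real.rpow_add hR0, Real.rpow_neg hR0.le]
          field_simp
        calc (R / 2) ^ (-((d : ℝ) + m)) *
              (C * (R ^ (d : ℝ) * (distBd Ω z + R) ^ (-(α + β))))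
            = ((R / 2) ^ (-((d : ℝ) + m)) * R ^ (d : ℝ)) * C *
              ((distBd Ω z + R) ^ (-β) * (distBd Ω z + R) ^ (-α)) := by
              rw [neg_add_rev α β, Real.rpow_add hsum]
              ring
          _ ≤ ((R / 2) ^ (-((d : ℝ) + m)) * R ^ (d : ℝ)) * C *
              (distBd Ω y ^ (-β) * distBd Ω z ^ (-α)) := by gcongr
          _ = _ := by
              rw [e1]
              ring

/-- The weighted integral of the non-absorbed part is controlled by the mixed seminorm. -/
lemma lintegral_bdPow_mul_nearInd_mul_incrPow_le (hopen : IsOpen Ω)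
    (hE : (frontier Ω).Nonempty)
    {s p α β ε C M : ℝ} (hs : 0 < s) (hp : 1 ≤ p) (hα : 0 ≤ α) (hβ : 0 ≤ β) (hC : 0 < C)
    (hε : ε ≤ 1 / 2) (hM : ∀ x ∈ Ω, ∀ y ∈ Ω, dist x y ≤ M)
    (hA1 : ∀ z ∈ Ω, ∀ R : ℝ, 0 < R → R ≤ M →
      ∫⁻ x in Ω ∩ ball z R, ENNReal.ofReal (distBd Ω x ^ (-(α + β)))
        ≤ ENNReal.ofReal (C * (R ^ (d : ℝ) * (distBd Ω z + R) ^ (-(α + β)))))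
    {f : Rd d → ℝ} (hf : Measurable f) :
    ∫⁻ x in Ω, (∫⁻ y in Ω, ∫⁻ z in Ω,
        nearInd ε x y z * distPow (d + ((d : ℝ) + s * p)) x y * incrPow p f z y)
          * bdPow Ω (α + β) x
      ≤ ENNReal.ofReal (2 ^ (d + ((d : ℝ) + s * p)) * C) * gagP Ω s p α β f := by
  set m := (d : ℝ) + s * p with hm
  have hm0 : 0 ≤ m := by positivity
  set F : Rd d → Rd d → Rd d → ℝ≥0∞ := fun x y z =>
    nearInd ε x y z * distPow (d + m) x y * bdPow Ω (α + β) x * incrPow p f z y with hF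
  calc ∫⁻ x in Ω, (∫⁻ y in Ω, ∫⁻ z in Ω,
        nearInd ε x y z * distPow (d + m) x y * incrPow p f z y) * bdPow Ω (α + β) x
      = ∫⁻ x in Ω, ∫⁻ y in Ω, ∫⁻ z in Ω, F x y z := by
        refine lintegral_congr fun x => ?_
        rw [← lintegral_mul_const _ (by fun_prop)]
        refine lintegral_congr fun y => ?_
        rw [← lintegral_mul_const _ (by fun_prop)]
        refine lintegral_congr fun z => ?_
        simp only [hF]
        ring
    _ = ∫⁻ x in Ω, ∫⁻ z in Ω, ∫⁻ y in Ω, F x y z := by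
        refine lintegral_congr fun x => ?_
        exact lintegral_lintegral_swap (by unfold Function.uncurry; fun_prop)
    _ = ∫⁻ z in Ω, ∫⁻ x in Ω, ∫⁻ y in Ω, F x y z :=
        lintegral_lintegral_swap (by unfold Function.uncurry; fun_prop)
    _ = ∫⁻ z in Ω, ∫⁻ y in Ω, ∫⁻ x in Ω, F x y z := by
        refine lintegral_congr fun z => ?_
        exact lintegral_lintegral_swap (by unfold Function.uncurry; fun_prop)
    _ ≤ ∫⁻ z in Ω, ∫⁻ y in Ω, ENNReal.ofReal (2 ^ (d + m) * C) *
          (incrPow p f z y * distPow m z y * bdPow Ω β y * bdPow Ω α z) := by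
        refine setLIntegral_mono' hopen.measurableSet fun z hz =>
          setLIntegral_mono' hopen.measurableSet fun y hy => ?_
        rcases eq_or_ne z y with rfl | hzy
        · simp [hF, incrPow_self hp]
        calc ∫⁻ x in Ω, F x y z
            = (∫⁻ x in Ω, nearInd ε x y z * distPow (d + m) x y * bdPow Ω (α + β) x)
              * incrPow p f z y := lintegral_mul_const _ (by fun_prop)
          _ ≤ ENNReal.ofReal (2 ^ (d + m) * C) *
                (distPow m z y * bdPow Ω β y * bdPow Ω α z) * incrPow p f z y := by
              gcongr
              exact setLIntegral_bdPow_mul_nearInd_le hopen hE hm0 hα hβ hC hε hy hz hzy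
                (hA1 z hz _ (dist_pos.2 hzy) (hM z hz y hy))
          _ = _ := by ring
    _ = ENNReal.ofReal (2 ^ (d + m) * C) * gagP Ω s p α β f := by
        rw [gagP_eq, ← lintegral_const_mul _ (by fun_prop)]
        exact lintegral_congr fun z => lintegral_const_mul _ (by fun_prop)

/-- If the mixed seminorm is finite, then the unweighted inner integral is finite almost
everywhere. -/
lemma ae_lintegral_incrPow_mul_distPow_lt_top (hopen : IsOpen Ω) (hE : (frontier Ω).Nonempty)
    {s p α β M : ℝ} (hβ : 0 ≤ β) (hM : ∀ y ∈ Ω, distBd Ω y ≤ M)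
    {f : Rd d → ℝ} (hf : Measurable f) (hfin : gagP Ω s p α β f ≠ ⊤) :
    ∀ᵐ x ∂volume.restrict Ω,
      ∫⁻ y in Ω, incrPow p f x y * distPow ((d : ℝ) + s * p) x y < ⊤ := by
  rw [gagP_eq] at hfin
  filter_upwards [ae_lt_top (by fun_prop) hfin, ae_restrict_mem hopen.measurableSet]
    with x hx hxΩ
  have hx0 := distBd_pos hopen hE hxΩ
  have hM0 : 0 < M := hx0.trans_le (hM x hxΩ)
  set κ := ENNReal.ofReal (M ^ (-β)) * bdPow Ω α x with hκ
  have hκ0 : κ ≠ 0 := by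
    refine mul_ne_zero ?_ ?_
    · exact (ENNReal.ofReal_pos.2 (by positivity)).ne'
    · exact (ENNReal.ofReal_pos.2 (by positivity)).ne'
  have hle : (∫⁻ y in Ω, incrPow p f x y * distPow ((d : ℝ) + s * p) x y) * κ
      ≤ ∫⁻ y in Ω,
        incrPow p f x y * distPow ((d : ℝ) + s * p) x y * bdPow Ω β y * bdPow Ω α x := by
    rw [← lintegral_mul_const _ (by fun_prop)]
    refine setLIntegral_mono' hopen.measurableSet fun y hy => ?_
    rw [hκ, ← mul_assoc]
    gcongr
    exact ENNReal.ofReal_le_ofReal (Real.rpow_le_rpow_of_nonpos (distBd_pos hopen hE hy)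
      (hM y hy) (by linarith))
  by_contra hcon
  rw [not_lt_top_iff] at hcon
  rw [hcon, ENNReal.top_mul hκ0] at hle
  exact hx.not_ge hle

lemma ENNReal.le_two_mul_of_le_half_mul_add {a b : ℝ≥0∞} (ha : a ≠ ⊤) (h : a ≤ 2⁻¹ * a + b) :
    a ≤ 2 * b := by
  have hsplit : 2⁻¹ * a + 2⁻¹ * a = a := by
    rw [← add_mul, ENNReal.inv_two_add_inv_two, one_mul]
  have hhalf : 2⁻¹ * a ≤ b := by
    refine (ENNReal.add_le_add_iff_left (ENNReal.mul_ne_top (by simp) ha)).1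
      (hsplit.trans_le h)
  calc a = 2⁻¹ * a + 2⁻¹ * a := hsplit.symm
    _ ≤ b + b := by gcongr
    _ = 2 * b := (two_mul b).symm

lemma exists_pos_le_half_mul_rpow_le {K σ : ℝ} (hK : 0 < K) (hσ : 0 < σ) :
    ∃ ε : ℝ, 0 < ε ∧ ε ≤ 1 / 2 ∧ K * ε ^ σ ≤ 2⁻¹ := by
  refine ⟨min (1 / 2) ((2 * K)⁻¹ ^ σ⁻¹), by positivity, min_le_left _ _, ?_⟩
  calc K * min (1 / 2) ((2 * K)⁻¹ ^ σ⁻¹) ^ σ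
      ≤ K * ((2 * K)⁻¹ ^ σ⁻¹) ^ σ := by
        gcongr
        exact min_le_right _ _
    _ = 2⁻¹ := by
        rw [Real.rpow_inv_rpow (by positivity) hσ.ne']
        field_simp

/-- The one-sided weighted seminorm is controlled by the mixed one. -/
lemma exists_gagP_le (hopen : IsOpen Ω) (hbdd : Bornology.IsBounded Ω)
    (hunif : IsUniformDomain Ω) {s p α β q : ℝ} (hs : 0 < s) (hp : 1 ≤ p)
    (hα : 0 ≤ α) (hβ : 0 ≤ β) (hE : (frontier Ω).Nonempty)
    (hdiam : 0 < Metric.ediam (frontier Ω)) (hq : q ∈ lowerCodimSet (frontier Ω))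
    (hαβq : α + β < q) :
    ∃ c : ℝ, 0 < c ∧ ∀ f : Rd d → ℝ, Measurable f →
      gagP Ω s p (α + β) 0 f ≤ ENNReal.ofReal c * gagP Ω s p α β f := by
  obtain ⟨c₀, hc₀, hdens⟩ := exists_le_volume_inter_ball hopen hunif
  set m := (d : ℝ) + s * p with hm
  have hsp : 0 < s * p := by positivity
  have hm0 : 0 < m := by positivity
  obtain ⟨C₁, hC₁, htail⟩ := exists_setLIntegral_dist_rpow_le (d := d) (m := d + m) (by linarith)
  obtain ⟨M, hM⟩ := isBounded_iff.1 hbdd.closure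
  have hMΩ : ∀ x ∈ Ω, ∀ y ∈ Ω, dist x y ≤ M := fun x hx y hy =>
    hM (subset_closure hx) (subset_closure hy)
  have hMd : ∀ y ∈ Ω, distBd Ω y ≤ M := fun y hy => by
    obtain ⟨w, hw⟩ := hE
    exact (infDist_le_dist_of_mem hw).trans
      (hM (subset_closure hy) (frontier_subset_closure hw))
  obtain ⟨C₂, hC₂, hA1⟩ := exists_setLIntegral_distBd_le (add_nonneg hα hβ) hαβq hopen hbdd hE
    hdiam hq M
  obtain ⟨ε, hε, hε2, hεK⟩ := exists_pos_le_half_mul_rpow_le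
    (K := 2 ^ p / c₀ * C₁) (by positivity) hsp
  set K := 2 ^ p / c₀ * ε ^ (-(d : ℝ)) with hK
  have hK0 : 0 < K := by positivity
  refine ⟨2 * K * (2 ^ (d + m) * C₂), by positivity, fun f hf => ?_⟩
  by_cases hfin : gagP Ω s p α β f = ⊤
  · rw [hfin, ENNReal.mul_top (ENNReal.ofReal_pos.2 (by positivity)).ne']
    exact le_top
  set H : Rd d → ℝ≥0∞ := fun x => ∫⁻ y in Ω, incrPow p f x y * distPow m x y with hH
  set G : Rd d → ℝ≥0∞ := fun x => ∫⁻ y in Ω, ∫⁻ z in Ω,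
    nearInd ε x y z * distPow (d + m) x y * incrPow p f z y with hG
  have hle : ∀ x ∈ Ω, H x ≤ 2⁻¹ * H x + ENNReal.ofReal K * G x := by
    intro x hx
    calc H x ≤ ∫⁻ y in Ω, ENNReal.ofReal K *
          ((∫⁻ z in Ω, nearInd ε x y z * distPow (d + m) x y * incrPow p f x z)
            + ∫⁻ z in Ω, nearInd ε x y z * distPow (d + m) x y * incrPow p f z y) :=
          setLIntegral_mono' hopen.measurableSet fun y hy =>
            incrPow_mul_distPow_le hc₀ hdens hp hε (by linarith) hf hx hy
      _ = ENNReal.ofReal K * ((∫⁻ y in Ω, ∫⁻ z in Ω,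
            nearInd ε x y z * distPow (d + m) x y * incrPow p f x z) + G x) := by
          rw [lintegral_const_mul _ (by fun_prop), lintegral_add_left (by fun_prop)]
      _ ≤ ENNReal.ofReal K * (ENNReal.ofReal (C₁ * ε ^ m) * H x + G x) := by
          gcongr
          exact lintegral_nearInd_mul_incrPow_le hp hε hC₁ htail hf x
      _ ≤ 2⁻¹ * H x + ENNReal.ofReal K * G x := by
          rw [mul_add, ← mul_assoc]
          gcongr
          rw [← ENNReal.ofReal_mul hK0.le]
          refine (ENNReal.ofReal_le_ofReal (q := 2⁻¹) ?_).trans_eq ?_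
          · refine le_trans (le_of_eq ?_) hεK
            rw [hK, hm, Real.rpow_add hε, Real.rpow_neg hε.le]
            field_simp
          · rw [ENNReal.ofReal_inv_of_pos two_pos, ENNReal.ofReal_ofNat]
  have hae : ∀ᵐ x ∂volume.restrict Ω, H x ≤ 2 * (ENNReal.ofReal K * G x) := by
    filter_upwards [ae_lintegral_incrPow_mul_distPow_lt_top hopen hE hβ hMd hf hfin,
      ae_restrict_mem hopen.measurableSet] with x hx hxΩ
    exact ENNReal.le_two_mul_of_le_half_mul_add hx.ne (hle x hxΩ)
  calc gagP Ω s p (α + β) 0 f = ∫⁻ x in Ω, H x * bdPow Ω (α + β) x := gagP_zero_eq hf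
    _ ≤ ∫⁻ x in Ω, ENNReal.ofReal (2 * K) * (G x * bdPow Ω (α + β) x) := by
        refine lintegral_mono_ae (hae.mono fun x hx => ?_)
        rw [ENNReal.ofReal_mul two_pos.le, ENNReal.ofReal_ofNat, ← mul_assoc, mul_assoc 2]
        gcongr
    _ = ENNReal.ofReal (2 * K) * ∫⁻ x in Ω, G x * bdPow Ω (α + β) x :=
        lintegral_const_mul _ (by fun_prop)
    _ ≤ ENNReal.ofReal (2 * K) *
          (ENNReal.ofReal (2 ^ (d + m) * C₂) * gagP Ω s p α β f) := by
        gcongr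
        exact lintegral_bdPow_mul_nearInd_mul_incrPow_le hopen hE hs hp hα hβ hC₂ hε2 hMΩ hA1 hf
    _ = _ := by
        rw [← mul_assoc, ← ENNReal.ofReal_mul (by positivity)]

lemma gagSemi_le_of_gagP_le {s p α β α' β' c : ℝ} (hp : 1 ≤ p) (hc : 0 ≤ c) {f g : Rd d → ℝ}
    (h : gagP Ω s p α β f ≤ ENNReal.ofReal c * gagP Ω s p α' β' g) :
    gagSemi Ω s p α β f ≤ ENNReal.ofReal (c ^ (1 / p)) * gagSemi Ω s p α' β' g := by
  have hp' : 0 ≤ 1 / p := by positivity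
  rw [gagSemi, gagSemi, ← ENNReal.ofReal_rpow_of_nonneg hc hp',
    ← ENNReal.mul_rpow_of_nonneg _ _ hp']
  gcongr

end Comparison

/-- comparability of the seminorms `[f]_{W^{s,p;α,β}(Ω)}` and
`[f]_{W^{s,p;α+β,0}(Ω)}`. -/
theorem stmt2 {d : ℕ} (Ω : Set (Rd d)) (hne : Ω.Nonempty)
    (hopen : IsOpen Ω) (hconn : IsConnected Ω) (hbdd : Bornology.IsBounded Ω)
    (hunif : IsUniformDomain Ω) (s p α β : ℝ)
    (hs0 : 0 < s) (hs1 : s < 1) (hp : 1 ≤ p)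
    (hα0 : 0 ≤ α) (hβ0 : 0 ≤ β)
    (hα : α < lowerCodimA (frontier Ω)) (hβ : β < lowerCodimA (frontier Ω))
    (hαβ : α + β < lowerCodimA (frontier Ω)) :
    (∀ f : Rd d → ℝ, LocallyIntegrableOn f Ω volume →
      gagSemi Ω s p α β f ≤ ENNReal.ofReal ((2 : ℝ) ^ (1 / p)) * gagSemi Ω s p (α + β) 0 f)
    ∧ ∃ c : ℝ, 0 < c ∧ ∀ f : Rd d → ℝ, LocallyIntegrableOn f Ω volume →
      gagSemi Ω s p (α + β) 0 f ≤ ENNReal.ofReal c * gagSemi Ω s p α β f := by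
  have hpos : 0 < lowerCodimA (frontier Ω) := (add_nonneg hα0 hβ0).trans_lt hαβ
  have hdiam := ediam_pos_of_lowerCodimA_pos hpos
  have hE : (frontier Ω).Nonempty := by
    by_contra h
    rw [not_nonempty_iff_eq_empty] at h
    simp [h] at hdiam
  have hset : (lowerCodimSet (frontier Ω)).Nonempty := by
    by_contra h
    rw [not_nonempty_iff_eq_empty] at h
    simp [lowerCodimA, h] at hpos
  obtain ⟨q, hq, hαβq⟩ := exists_lt_of_lt_csSup hset hαβ
  have hmeas : ∀ f : Rd d → ℝ, LocallyIntegrableOn f Ω volume →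
      ∃ g : Rd d → ℝ, Measurable g ∧ f =ᵐ[volume.restrict Ω] g := fun f hf =>
    ⟨_, hf.aestronglyMeasurable.aemeasurable.measurable_mk,
      hf.aestronglyMeasurable.aemeasurable.ae_eq_mk⟩
  refine ⟨fun f hf => ?_, ?_⟩
  · obtain ⟨g, hg, hfg⟩ := hmeas f hf
    refine gagSemi_le_of_gagP_le hp two_pos.le ?_
    rw [gagP_congr_ae hfg, gagP_congr_ae hfg, ENNReal.ofReal_ofNat]
    exact gagP_le_two_mul hopen hE hα0 hβ0 hg
  · obtain ⟨c, hc, h⟩ := exists_gagP_le (s := s) (p := p) hopen hbdd hunif hs0 hp hα0 hβ0 hE hdiam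
      hq hαβq
    refine ⟨c ^ (1 / p), by positivity, fun f hf => ?_⟩
    obtain ⟨g, hg, hfg⟩ := hmeas f hf
    refine gagSemi_le_of_gagP_le hp hc.le ?_
    rw [gagP_congr_ae hfg, gagP_congr_ae hfg]
    exact h g hg
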